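/- Let D = (0,2π)², let U ⊂ ℝ be a bounded open interval, and write (x¹,x²) = (μ,ν). Let α^{ij} ∈ C^∞(ℝ² × U) (i,j = 1,2) and S ∈ C^∞(ℝ² × U) be smooth functions that are 2π-periodic in μ and in ν, with α^{ij} = α^{ji}. Assume ∫_D S(μ,ν,Ψ) dμ dν = 0 for every Ψ ∈ U, and that there is a constant λ > 0 such that α^{ij}(μ,ν,Ψ) ξ_i ξ_j ≥ λ|ξ|² for all ξ ∈ ℝ², all (μ,ν) ∈ [0,2π)², and all Ψ ∈ U. Then there exists a unique function ρ ∈ C^∞(ℝ² × U), 2π-periodic in μ and in ν (hence with all its partial derivatives 2π-periodic in μ and ν), satisfying ∂/∂x^i(α^{ij} ∂ρ/∂x^j) = S on ℝ² × U and ∫_D ρ(μ,ν,Ψ) dμ dν = 0 for every Ψ ∈ U. -/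

import Mathlib

open scoped Real
open MeasureTheory

/-- Partial derivative with respect to `μ` (the first variable of `ℝ × ℝ × ℝ`). -/
noncomputable def pdμ (f : ℝ × ℝ × ℝ → ℝ) (p : ℝ × ℝ × ℝ) : ℝ := fderiv ℝ f p (1, 0, 0)

/-- Partial derivative with respect to `ν` (the second variable of `ℝ × ℝ × ℝ`). -/
noncomputable def pdν (f : ℝ × ℝ × ℝ → ℝ) (p : ℝ × ℝ × ℝ) : ℝ := fderiv ℝ f p (0, 1, 0)

/-- Indexed family `(∂/∂x¹, ∂/∂x²) = (∂/∂μ, ∂/∂ν)`. -/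
noncomputable def pdi : Fin 2 → (ℝ × ℝ × ℝ → ℝ) → ℝ × ℝ × ℝ → ℝ := ![pdμ, pdν]

/-- The properties required of the solution `ρ` of the periodic boundary value problem
`∂/∂x^i (α^{ij} ∂ρ/∂x^j) = S`, `⟨ρ⟩ = 0`, `ρ` doubly `2π`-periodic, smooth on `ℝ² × U`. -/
def IsPeriodicSolution (U : Set ℝ) (α : Fin 2 → Fin 2 → ℝ × ℝ × ℝ → ℝ)
    (S : ℝ × ℝ × ℝ → ℝ) (ρ : ℝ × ℝ × ℝ → ℝ) : Prop :=
  ContDiffOn ℝ (⊤ : ℕ∞) ρ {p : ℝ × ℝ × ℝ | p.2.2 ∈ U} ∧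
  (∀ p : ℝ × ℝ × ℝ, ρ (p.1 + 2 * π, p.2.1, p.2.2) = ρ p) ∧
  (∀ p : ℝ × ℝ × ℝ, ρ (p.1, p.2.1 + 2 * π, p.2.2) = ρ p) ∧
  (∀ p : ℝ × ℝ × ℝ, p.2.2 ∈ U →
    (∑ i : Fin 2, pdi i (fun q => ∑ j : Fin 2, α i j q * pdi j ρ q) p) = S p) ∧
  (∀ Ψ ∈ U, ∫ q in Set.Ioo (0:ℝ) (2*π) ×ˢ Set.Ioo (0:ℝ) (2*π), ρ (q.1, q.2, Ψ) = 0)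

section ParametricContinuousMaps

variable {K B E F : Type*} [TopologicalSpace K]
  [NormedAddCommGroup B] [NormedAddCommGroup E] [NormedAddCommGroup F]

/-- The restriction `k ↦ g (ι k, t)` of a continuous function `g` to the slice at `t`, as a
continuous function on `K`. -/
def sliceMap (ι : C(K, B)) (g : C(B × E, F)) (t : E) : C(K, F) :=
  ⟨fun k => g (ι k, t), by fun_prop⟩

theorem continuous_sliceMap (ι : C(K, B)) (g : C(B × E, F)) : Continuous (sliceMap ι g) :=
  ContinuousMap.continuous_of_continuous_uncurry _ (by
    change Continuous fun p : E × K => g (ι p.2, p.1)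
    fun_prop)

variable [CompactSpace K] [NormedSpace ℝ B] [NormedSpace ℝ E] [NormedSpace ℝ F]

theorem hasFDerivAt_sliceMap [FiniteDimensional ℝ E] (ι : C(K, B)) (g : C(B × E, F))
    (hg : ContDiff ℝ 1 g) (t : E) :
    ∃ L : E →L[ℝ] C(K, F), HasFDerivAt (sliceMap ι g) L t ∧
      ∀ y k, L y k = fderiv ℝ g (ι k, t) (0, y) := by
  have hcont : Continuous fun p => (fderiv ℝ g p) := hg.continuous_fderiv (by norm_num)
  let D : C(B × E, E →L[ℝ] F) :=
    ⟨fun p => (fderiv ℝ g p).comp (ContinuousLinearMap.inr ℝ B E), by fun_prop⟩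
  let L₀ : E →ₗ[ℝ] C(K, F) :=
    { toFun := fun y => ⟨fun k => D (ι k, t) y, by fun_prop⟩
      map_add' := fun y z => by ext k; simp
      map_smul' := fun c y => by ext k; simp }
  refine ⟨LinearMap.toContinuousLinearMap L₀, ?_, fun y k => by simp [L₀, D]⟩
  rw [hasFDerivAt_iff_isLittleO, Asymptotics.isLittleO_iff]
  intro ε hε
  have hD := (continuous_sliceMap ι D).continuousAt (x := t)
  rw [Metric.continuousAt_iff] at hD
  obtain ⟨δ, hδ, hδ'⟩ := hD ε hε
  filter_upwards [Metric.ball_mem_nhds t hδ] with s hs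
  rw [ContinuousMap.norm_le _ (by positivity)]
  intro k
  have hder : ∀ r : E, HasFDerivAt (fun r => g (ι k, r)) (D (ι k, r)) r := by
    intro r
    have h1 : HasFDerivAt g (fderiv ℝ g (ι k, r)) (ι k, r) :=
      (hg.differentiable (by norm_num) _).hasFDerivAt
    exact h1.comp r (hasFDerivAt_prodMk_right (ι k) r)
  have := (convex_ball t δ).norm_image_sub_le_of_norm_hasFDerivWithin_le'
    (f := fun r => g (ι k, r)) (f' := fun r => D (ι k, r)) (φ := D (ι k, t)) (C := ε)
    (x := t) (y := s)
    (fun r _ => (hder r).hasFDerivWithinAt) (fun r hr => ?_) (Metric.mem_ball_self hδ) hs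
  · simpa [L₀, sliceMap] using this
  · have h2 := (hδ' hr).le
    rw [dist_eq_norm] at h2
    exact ((sliceMap ι D r - sliceMap ι D t).norm_coe_le_norm k).trans h2

theorem contDiff_sliceMap [FiniteDimensional ℝ E] (ι : C(K, B)) (n : ℕ) :
    ∀ g : C(B × E, F), ContDiff ℝ (⊤ : ℕ∞) g → ContDiff ℝ n (sliceMap ι g) := by
  induction n with
  | zero => exact fun g _ => contDiff_zero.2 (continuous_sliceMap ι g)
  | succ n ih =>
    intro g hg
    have h1 : ContDiff ℝ 1 g := hg.of_le (by exact_mod_cast le_top)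
    push_cast
    rw [contDiff_succ_iff_fderiv_apply]
    refine ⟨fun t => ?_, by simp, fun y => ?_⟩
    · obtain ⟨L, hL, -⟩ := hasFDerivAt_sliceMap ι g h1 t
      exact hL.differentiableAt
    · have hsm : ContDiff ℝ (⊤ : ℕ∞) fun p => fderiv ℝ g p (0, y) :=
        (hg.fderiv_right (m := (⊤ : ℕ∞)) (by simp)).clm_apply contDiff_const
      convert ih ⟨fun p => fderiv ℝ g p (0, y), hsm.continuous⟩ hsm using 1
      ext t k
      obtain ⟨L, hL, hL'⟩ := hasFDerivAt_sliceMap ι g h1 t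
      rw [hL.fderiv, hL']
      rfl

/-- Integration against a finite measure, as a continuous linear functional. -/
noncomputable def integralCLM [MeasurableSpace K] [BorelSpace K] (μ : Measure K)
    [IsFiniteMeasure μ] : C(K, ℝ) →L[ℝ] ℝ :=
  LinearMap.mkContinuous
    { toFun := fun f => ∫ k, f k ∂μ
      map_add' := fun f g => integral_add
        (f.continuous.integrable_of_hasCompactSupport (HasCompactSupport.of_compactSpace _))
        (g.continuous.integrable_of_hasCompactSupport (HasCompactSupport.of_compactSpace _))
      map_smul' := fun c f => integral_const_mul c _ }
    (μ.real Set.univ) (fun f => by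
      rw [mul_comm]
      exact norm_integral_le_of_norm_le_const (.of_forall f.norm_coe_le_norm))

theorem contDiff_unitInterval_integral [FiniteDimensional ℝ E] {g : ℝ × E → ℝ}
    (hg : ContDiff ℝ (⊤ : ℕ∞) g) :
    ContDiff ℝ (⊤ : ℕ∞) fun t => ∫ θ in (0 : ℝ)..1, g (θ, t) := by
  rw [contDiff_infty]
  intro n
  have h := (integralCLM (volume : Measure unitInterval)).contDiff.comp
    (contDiff_sliceMap (⟨fun θ => (θ : ℝ), by fun_prop⟩ : C(unitInterval, ℝ)) n
      ⟨g, hg.continuous⟩ hg)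
  convert h using 1
  ext t
  rw [intervalIntegral.integral_of_le zero_le_one, ← integral_Icc_eq_integral_Ioc]
  exact (integral_subtype_comap measurableSet_Icc fun θ : ℝ => g (θ, t)).symm

end ParametricContinuousMaps

/-- The horizontal coordinate directions of `ℝ × ℝ × ℝ`. -/
def horiz : Fin 2 → ℝ × ℝ × ℝ := ![(1, 0, 0), (0, 1, 0)]

/-- The algebra of smooth functions on `ℝ × ℝ × ℝ` that are `2π`-periodic in the first two
variables. -/
noncomputable def smoothPeriodic : Subalgebra ℝ (ℝ × ℝ × ℝ → ℝ) where
  carrier := {f | ContDiff ℝ (⊤ : ℕ∞) f ∧ ∀ i p, f (p + (2 * π) • horiz i) = f p}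
  mul_mem' hf hg := ⟨hf.1.mul hg.1, fun i p => by simp [hf.2, hg.2]⟩
  add_mem' hf hg := ⟨hf.1.add hg.1, fun i p => by simp [hf.2, hg.2]⟩
  algebraMap_mem' r := ⟨contDiff_const, fun i p => rfl⟩

/-- Smooth functions on `ℝ × ℝ × ℝ`, `2π`-periodic in the first two variables. -/
abbrev PeriodicFunction : Type := smoothPeriodic

/-- The unit square, which parametrizes a period cell. -/
abbrev UnitSquare := unitInterval × unitInterval

namespace PeriodicFunction

theorem contDiff (f : PeriodicFunction) : ContDiff ℝ (⊤ : ℕ∞) (f : ℝ × ℝ × ℝ → ℝ) := f.2.1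

@[fun_prop]
theorem continuous (f : PeriodicFunction) : Continuous (f : ℝ × ℝ × ℝ → ℝ) := f.contDiff.continuous

theorem differentiable (f : PeriodicFunction) : Differentiable ℝ (f : ℝ × ℝ × ℝ → ℝ) :=
  f.contDiff.differentiable (by simp)

theorem periodic (f : PeriodicFunction) (i : Fin 2) (p : ℝ × ℝ × ℝ) :
    f.1 (p + (2 * π) • horiz i) = f.1 p := f.2.2 i p

/-- The partial derivative in a horizontal direction. -/
noncomputable def pd (i : Fin 2) : PeriodicFunction →ₗ[ℝ] PeriodicFunction where
  toFun f := ⟨fun p => fderiv ℝ f.1 p (horiz i),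
    (f.contDiff.fderiv_right (m := (⊤ : ℕ∞)) (by simp)).clm_apply contDiff_const, fun j p => by
      change fderiv ℝ f.1 (p + _) (horiz i) = fderiv ℝ f.1 p (horiz i)
      have h := fderiv_comp_add_right (𝕜 := ℝ) (f := f.1) (x := p) ((2 * π) • horiz j)
      rw [← h]
      congr 2
      exact funext (f.periodic j)⟩
  map_add' f g := by
    ext p
    exact congrArg (· (horiz i)) (fderiv_add (f.differentiable p) (g.differentiable p))
  map_smul' c f := by
    ext p
    exact congrArg (· (horiz i)) (fderiv_const_smul (f.differentiable p) c)

theorem pd_apply (i : Fin 2) (f : PeriodicFunction) (p : ℝ × ℝ × ℝ) :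
    (pd i f).1 p = fderiv ℝ f.1 p (horiz i) := rfl

theorem pd_mul (i : Fin 2) (f g : PeriodicFunction) : pd i (f * g) = pd i f * g + f * pd i g := by
  ext p
  have h := fderiv_mul (f.differentiable p) (g.differentiable p)
  have h' := congrArg (· (horiz i)) h
  simp only [pd_apply]
  change fderiv ℝ (f.1 * g.1) p (horiz i) = _
  rw [h']
  simp [pd_apply]
  ring

theorem hasDerivAt_line (f : PeriodicFunction) (i : Fin 2) (p : ℝ × ℝ × ℝ) (c s : ℝ) :
    HasDerivAt (fun s : ℝ => f.1 (p + (c * s) • horiz i))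
      (c * (pd i f).1 (p + (c * s) • horiz i)) s := by
  have h1 : HasDerivAt (fun s : ℝ => p + (c * s) • horiz i) (c • horiz i) s := by
    have := (((hasDerivAt_id s).const_mul c).smul_const (horiz i)).const_add p
    simpa using this
  have := (f.differentiable (p + (c * s) • horiz i)).hasFDerivAt.comp_hasDerivAt s h1
  simpa [pd_apply, Function.comp_def] using this

/-- Translation of functions. -/
noncomputable def shift (t : ℝ × ℝ × ℝ) : PeriodicFunction →ₐ[ℝ] PeriodicFunction where
  toFun f := ⟨fun p => f.1 (p + t), f.contDiff.comp (contDiff_id.add contDiff_const), fun i p => by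
    change f.1 (p + _ + t) = f.1 (p + t)
    rw [add_right_comm]; exact f.periodic i _⟩
  map_one' := rfl
  map_mul' _ _ := rfl
  map_zero' := rfl
  map_add' _ _ := rfl
  commutes' _ := rfl

theorem shift_apply (t : ℝ × ℝ × ℝ) (f : PeriodicFunction) (p : ℝ × ℝ × ℝ) :
    (shift t f).1 p = f.1 (p + t) := rfl

theorem shift_shift (s t : ℝ × ℝ × ℝ) (f : PeriodicFunction) :
    shift s (shift t f) = shift (s + t) f := by
  ext p
  simp [shift_apply, add_assoc]

theorem shift_zero (f : PeriodicFunction) : shift 0 f = f := by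
  ext p
  simp [shift_apply]

theorem pd_shift (i : Fin 2) (t : ℝ × ℝ × ℝ) (f : PeriodicFunction) :
    pd i (shift t f) = shift t (pd i f) := by
  ext p
  exact congrArg (· (horiz i)) (fderiv_comp_add_right (𝕜 := ℝ) (f := f.1) (x := p) t)

/-- The average over a period in a horizontal direction. -/
noncomputable def lineMean (i : Fin 2) (f : PeriodicFunction) : PeriodicFunction :=
  ⟨fun p => ∫ θ in (0 : ℝ)..1, f.1 (p + (2 * π * θ) • horiz i),
    contDiff_unitInterval_integral (g := fun q : ℝ × (ℝ × ℝ × ℝ) =>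
      f.1 (q.2 + (2 * π * q.1) • horiz i)) (f.contDiff.comp (by fun_prop)), fun j p => by
      refine intervalIntegral.integral_congr fun θ _ => ?_
      rw [add_right_comm, f.periodic]⟩

theorem lineMean_apply (i : Fin 2) (f : PeriodicFunction) (p : ℝ × ℝ × ℝ) :
    (lineMean i f).1 p = ∫ θ in (0 : ℝ)..1, f.1 (p + (2 * π * θ) • horiz i) := rfl

theorem lineMean_add_smul (i : Fin 2) (f : PeriodicFunction) (p : ℝ × ℝ × ℝ) (r : ℝ) :
    (lineMean i f).1 (p + r • horiz i) = (lineMean i f).1 p := by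
  have hper : Function.Periodic (fun θ : ℝ => f.1 (p + (2 * π * θ) • horiz i)) 1 := fun θ => by
    change f.1 (p + (2 * π * (θ + 1)) • horiz i) = _
    simp only [mul_add, mul_one, add_smul, ← add_assoc, f.periodic]
  have h := hper.intervalIntegral_add_eq (r / (2 * π)) 0
  have hπ : 2 * π ≠ 0 := by positivity
  rw [zero_add] at h
  rw [lineMean_apply, lineMean_apply, ← h, add_comm (r / (2 * π)) 1]
  have h2 := intervalIntegral.integral_comp_add_right (a := 0) (b := 1)
    (fun θ : ℝ => f.1 (p + (2 * π * θ) • horiz i)) (r / (2 * π))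
  rw [zero_add] at h2
  rw [← h2]
  congr 1
  ext θ
  rw [mul_add, mul_div_cancel₀ _ hπ, add_smul, add_right_comm, add_assoc]

theorem lineMean_pd (i : Fin 2) (f : PeriodicFunction) : lineMean i (pd i f) = 0 := by
  ext p
  have hπ : 2 * π ≠ 0 := by positivity
  have h := intervalIntegral.integral_eq_sub_of_hasDerivAt (a := 0) (b := 1)
    (fun s _ => f.hasDerivAt_line i p (2 * π) s) (Continuous.intervalIntegrable (by fun_prop) _ _)
  rw [intervalIntegral.integral_const_mul, mul_one, f.periodic] at h
  rw [lineMean_apply]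
  simpa using h

theorem lineMean_reconstruct (i : Fin 2) (f : PeriodicFunction) (p : ℝ × ℝ × ℝ) :
    f.1 p = ∫ θ in (0 : ℝ)..1, (f.1 (p + (2 * π * θ) • horiz i) +
      2 * π * (θ - 1) * (pd i f).1 (p + (2 * π * θ) • horiz i)) := by
  have h := intervalIntegral.integral_eq_sub_of_hasDerivAt (a := 0) (b := 1)
    (fun s _ => ((hasDerivAt_id s).sub_const 1).mul (f.hasDerivAt_line i p (2 * π) s))
    (Continuous.intervalIntegrable (by fun_prop) _ _)
  simp only [Pi.mul_apply, id, sub_self, zero_mul, mul_zero, zero_smul, add_zero, zero_sub,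
    neg_mul, one_mul, neg_neg] at h
  rw [← h]
  congr 1
  ext θ
  ring

theorem exists_pd_eq_of_lineMean_eq_zero (i : Fin 2) (f : PeriodicFunction) (hf : lineMean i f = 0) :
    ∃ g, pd i g = f := by
  let c : Fin 2 → (ℝ × ℝ × ℝ →L[ℝ] ℝ) := ![ContinuousLinearMap.fst ℝ ℝ (ℝ × ℝ),
    (ContinuousLinearMap.fst ℝ ℝ ℝ).comp (ContinuousLinearMap.snd ℝ ℝ (ℝ × ℝ))]
  have hc : ∀ i j, c i (horiz j) = if i = j then 1 else 0 := by
    intro i j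
    fin_cases i <;> fin_cases j <;> simp [c, horiz]
  let g : ℝ × ℝ × ℝ → ℝ := fun p => ∫ s in (0 : ℝ)..c i p, f.1 (p - c i p • horiz i + s • horiz i)
  have hline : ∀ q a, ∫ s in a..a + 2 * π, f.1 (q + s • horiz i) = 0 := by
    intro q a
    have h : (lineMean i f).1 (q + a • horiz i) = 0 := by rw [hf]; rfl
    have hπ : 2 * π ≠ 0 := by positivity
    have h2 := intervalIntegral.integral_comp_add_mul (a := 0) (b := 1)
      (fun s : ℝ => f.1 (q + s • horiz i)) hπ a
    simp only [mul_zero, add_zero, mul_one] at h2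
    have h3 : (∫ x in (0 : ℝ)..1, f.1 (q + (a + 2 * π * x) • horiz i)) = 0 := by
      rw [lineMean_apply] at h
      rw [← h]
      congr! 3
      rw [add_smul, add_assoc]
    rw [h3] at h2
    simpa [hπ] using h2.symm
  have hmem : g ∈ smoothPeriodic := by
    constructor
    · have : g = fun p => c i p * ∫ θ in (0 : ℝ)..1,
          f.1 (p - c i p • horiz i + (θ * c i p) • horiz i) := by
        ext p
        have := intervalIntegral.smul_integral_comp_mul_right (a := 0) (b := 1)
          (fun s : ℝ => f.1 (p - c i p • horiz i + s • horiz i)) (c i p)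
        simpa [g] using this.symm
      rw [this]
      refine (c i).contDiff.mul (contDiff_unitInterval_integral (g := fun q : ℝ × (ℝ × ℝ × ℝ) =>
        f.1 (q.2 - c i q.2 • horiz i + (q.1 * c i q.2) • horiz i)) (f.contDiff.comp (by fun_prop)))
    · intro j p
      have h1 : p + (2 * π) • horiz j - c i (p + (2 * π) • horiz j) • horiz i =
          p - c i p • horiz i + (if i = j then 0 else 2 * π) • horiz j := by
        rw [map_add, map_smul, hc]
        split_ifs with hij
        · subst hij; simp [add_smul]
        · simp; abel
      have h2 : c i (p + (2 * π) • horiz j) = c i p + if i = j then 2 * π else 0 := by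
        rw [map_add, map_smul, hc]; split_ifs <;> simp
      simp only [g]
      rw [h1, h2]
      split_ifs with hij
      · rw [← intervalIntegral.integral_add_adjacent_intervals (b := c i p)
          (Continuous.intervalIntegrable (by fun_prop) _ _)
          (Continuous.intervalIntegrable (by fun_prop) _ _), zero_smul, add_zero, hline, add_zero]
      · simp_rw [add_right_comm _ ((2 * π) • horiz j), f.periodic, add_zero]
  refine ⟨⟨g, hmem⟩, ?_⟩
  ext p
  have h1 := hasDerivAt_line ⟨g, hmem⟩ i p 1 0
  have h2 : HasDerivAt (fun s : ℝ => g (p + (1 * s) • horiz i)) (f.1 p) 0 := by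
    have h3 : ∀ s : ℝ, g (p + (1 * s) • horiz i) =
        ∫ r in (0 : ℝ)..c i p + s, f.1 (p - c i p • horiz i + r • horiz i) := by
      intro s
      simp only [g, one_mul, map_add, map_smul, hc, if_true, smul_eq_mul, mul_one]
      congr! 4
      rw [add_smul]; abel
    simp_rw [h3]
    have h4 : Continuous fun r : ℝ => f.1 (p - c i p • horiz i + r • horiz i) := by fun_prop
    have h5 := intervalIntegral.integral_hasDerivAt_right (a := 0) (b := c i p + 0)
      (h4.intervalIntegrable _ _) (h4.stronglyMeasurableAtFilter _ _) h4.continuousAt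
    have h6 := h5.comp_const_add (c i p) 0
    simpa using h6
  have := h1.unique h2
  simpa using this

/-- The period square `[0, 2π]²` at height `0`, parametrized by the unit square. -/
noncomputable def square : C(UnitSquare, ℝ × ℝ × ℝ) :=
  ⟨fun k => (2 * π * (k.1 : ℝ)) • horiz 0 + (2 * π * (k.2 : ℝ)) • horiz 1, by fun_prop⟩

/-- Restriction of functions to the period square at height `0`. -/
noncomputable def res : PeriodicFunction →ₗ[ℝ] C(UnitSquare, ℝ) where
  toFun f := ⟨fun k => f.1 (square k), by fun_prop⟩
  map_add' _ _ := rfl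
  map_smul' _ _ := rfl

theorem res_apply (f : PeriodicFunction) (k : UnitSquare) : res f k = f.1 (square k) := rfl

theorem res_mul (f g : PeriodicFunction) : res (f * g) = res f * res g := rfl

theorem res_shift_eq_sliceMap (f : PeriodicFunction) :
    (fun t => res (shift t f)) = sliceMap square ⟨fun q => f.1 (q.1 + q.2), by fun_prop⟩ := rfl

theorem contDiff_res_shift (f : PeriodicFunction) :
    ContDiff ℝ (⊤ : ℕ∞) fun t => res (shift t f) := by
  rw [contDiff_infty]
  intro n
  rw [res_shift_eq_sliceMap]
  exact contDiff_sliceMap square n _ (f.contDiff.comp (by fun_prop))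

theorem fderiv_res_shift (f : PeriodicFunction) (t : ℝ × ℝ × ℝ) (i : Fin 2) :
    fderiv ℝ (fun t => res (shift t f)) t (horiz i) = res (shift t (pd i f)) := by
  rw [res_shift_eq_sliceMap]
  obtain ⟨L, hL, hL'⟩ := hasFDerivAt_sliceMap square
    (⟨fun q => f.1 (q.1 + q.2), by fun_prop⟩ : C((ℝ × ℝ × ℝ) × (ℝ × ℝ × ℝ), ℝ))
    ((f.contDiff.of_le (by simp)).comp (by fun_prop)) t
  rw [hL.fderiv]
  ext k
  rw [hL', res_apply, shift_apply, pd_apply]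
  have h1 := (f.differentiable (square k + t)).hasFDerivAt.comp (square k, t)
    ((hasFDerivAt_fst (𝕜 := ℝ) (p := (square k, t))).add hasFDerivAt_snd)
  have h2 := h1.fderiv
  have h3 := congrArg (· (0, horiz i)) h2
  simpa using! h3

/-- The mean over the period square at height `0`. -/
noncomputable def mean : PeriodicFunction →ₗ[ℝ] ℝ :=
  (integralCLM (volume : Measure (UnitSquare))).toLinearMap ∘ₗ res

theorem mean_apply (f : PeriodicFunction) : mean f = ∫ k : UnitSquare, f.1 (square k) := rfl

theorem integral_unitInterval (g : ℝ → ℝ) : ∫ x : unitInterval, g x = ∫ x in (0 : ℝ)..1, g x := by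
  rw [intervalIntegral.integral_of_le zero_le_one, ← integral_Icc_eq_integral_Ioc]
  exact integral_subtype_comap measurableSet_Icc g

theorem integrable_of_continuous {f : UnitSquare → ℝ} (hf : Continuous f) : Integrable f :=
  hf.integrable_of_hasCompactSupport (HasCompactSupport.of_compactSpace _)

theorem integral_square (g : ℝ → ℝ → ℝ) (hg : Continuous fun k : ℝ × ℝ => g k.1 k.2) :
    ∫ k : UnitSquare, g k.1 k.2 = ∫ x in (0 : ℝ)..1, ∫ y in (0 : ℝ)..1, g x y := by
  rw [Measure.volume_eq_prod, integral_prod _ (integrable_of_continuous (by fun_prop)),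
    ← integral_unitInterval]
  simp_rw [← integral_unitInterval]

theorem integral_square_symm (g : ℝ → ℝ → ℝ) (hg : Continuous fun k : ℝ × ℝ => g k.1 k.2) :
    ∫ k : UnitSquare, g k.1 k.2 = ∫ y in (0 : ℝ)..1, ∫ x in (0 : ℝ)..1, g x y := by
  rw [Measure.volume_eq_prod, integral_prod_symm _ (integrable_of_continuous (by fun_prop)),
    ← integral_unitInterval]
  simp_rw [← integral_unitInterval]

theorem mean_shift_eq_lineMean (f : PeriodicFunction) (t : ℝ × ℝ × ℝ) :
    mean (shift t f) = (lineMean 0 (lineMean 1 f)).1 t := by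
  have h := integral_square (fun x y =>
    f.1 ((2 * π * x) • horiz 0 + (2 * π * y) • horiz 1 + t)) (by fun_prop)
  refine h.trans ?_
  simp_rw [lineMean_apply]
  congr! 5
  abel

theorem mean_shift_eq_lineMean' (f : PeriodicFunction) (t : ℝ × ℝ × ℝ) :
    mean (shift t f) = (lineMean 1 (lineMean 0 f)).1 t := by
  have h := integral_square_symm (fun x y =>
    f.1 ((2 * π * x) • horiz 0 + (2 * π * y) • horiz 1 + t)) (by fun_prop)
  refine h.trans ?_
  simp_rw [lineMean_apply]
  congr! 5
  abel

theorem mean_shift_smul (i : Fin 2) (r : ℝ) (f : PeriodicFunction) :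
    mean (shift (r • horiz i) f) = mean f := by
  conv_rhs => rw [← shift_zero f]
  fin_cases i
  · rw [mean_shift_eq_lineMean, mean_shift_eq_lineMean]
    simpa using lineMean_add_smul 0 (lineMean 1 f) 0 r
  · rw [mean_shift_eq_lineMean', mean_shift_eq_lineMean']
    simpa using lineMean_add_smul 1 (lineMean 0 f) 0 r

theorem lineMean_zero (i : Fin 2) : lineMean i 0 = 0 := by
  ext p
  simp [lineMean_apply]

theorem mean_pd (i : Fin 2) (f : PeriodicFunction) : mean (pd i f) = 0 := by
  rw [← shift_zero (pd i f)]
  fin_cases i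
  · rw [mean_shift_eq_lineMean']
    change (lineMean 1 (lineMean 0 (pd 0 f))).1 0 = 0
    rw [lineMean_pd, lineMean_zero]; rfl
  · rw [mean_shift_eq_lineMean]
    change (lineMean 0 (lineMean 1 (pd 1 f))).1 0 = 0
    rw [lineMean_pd, lineMean_zero]; rfl

theorem mean_mul_pd (i : Fin 2) (f g : PeriodicFunction) :
    mean (f * pd i g) = - mean (pd i f * g) := by
  have h := mean_pd i (f * g)
  rw [pd_mul, map_add] at h
  linarith

theorem mean_shift_square (k : UnitSquare) (f : PeriodicFunction) :
    mean (shift (square k) f) = mean f := by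
  have : shift (square k) f = shift ((2 * π * (k.1 : ℝ)) • horiz 0)
      (shift ((2 * π * (k.2 : ℝ)) • horiz 1) f) := by
    rw [shift_shift]; rfl
  rw [this, mean_shift_smul, mean_shift_smul]

theorem exists_divergence_eq (S : PeriodicFunction) (hS : ∀ t, mean (shift t S) = 0) :
    ∃ σ : Fin 2 → PeriodicFunction, ∑ i, pd i (σ i) = S := by
  obtain ⟨σ₀, h₀⟩ := exists_pd_eq_of_lineMean_eq_zero 0 (S - lineMean 0 S) (by
    ext p
    have hint : ∀ f : PeriodicFunction, IntervalIntegrable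
        (fun θ : ℝ => f.1 (p + (2 * π * θ) • horiz 0)) volume 0 1 :=
      fun f => Continuous.intervalIntegrable (by fun_prop) _ _
    rw [lineMean_apply]
    change ∫ θ in (0 : ℝ)..1, (S.1 (p + (2 * π * θ) • horiz 0) -
      (lineMean 0 S).1 (p + (2 * π * θ) • horiz 0)) = 0
    rw [intervalIntegral.integral_sub (hint _) (hint _)]
    simp_rw [lineMean_add_smul]
    rw [← lineMean_apply]
    simp)
  obtain ⟨σ₁, h₁⟩ := exists_pd_eq_of_lineMean_eq_zero 1 (lineMean 0 S) (by
    ext p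
    rw [← mean_shift_eq_lineMean', hS]; rfl)
  exact ⟨![σ₀, σ₁], by simp [Fin.sum_univ_two, h₀, h₁]⟩

/-- The weight through which a horizontal derivative enters `reconstruct`. -/
noncomputable def weight : Fin 2 → C(UnitSquare, ℝ) :=
  ![⟨fun k => 2 * π * ((k.1 : ℝ) - 1), by fun_prop⟩, ⟨fun k => 2 * π * ((k.2 : ℝ) - 1), by fun_prop⟩]

theorem reconstruct (f : PeriodicFunction) (t : ℝ × ℝ × ℝ) :
    f.1 t = mean (shift t f) +
      (∫ k, res (shift t (pd 0 f)) k * weight 0 k) +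
      (∫ k, res (shift t (pd 1 f)) k * weight 1 k) +
      (∫ k, res (shift t (pd 1 (pd 0 f))) k * (weight 0 * weight 1) k) := by
  have hsq : ∀ k : UnitSquare, square k + t = t + (2 * π * (k.1 : ℝ)) • horiz 0 +
      (2 * π * (k.2 : ℝ)) • horiz 1 := fun k => by
    change _ + _ + t = _
    abel
  rw [mean_apply]
  rw [← integral_add, ← integral_add, ← integral_add]
  · have h := integral_square (fun x y =>
      f.1 (t + (2 * π * x) • horiz 0 + (2 * π * y) • horiz 1) +
      (pd 0 f).1 (t + (2 * π * x) • horiz 0 + (2 * π * y) • horiz 1) * (2 * π * (x - 1)) +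
      (pd 1 f).1 (t + (2 * π * x) • horiz 0 + (2 * π * y) • horiz 1) * (2 * π * (y - 1)) +
      (pd 1 (pd 0 f)).1 (t + (2 * π * x) • horiz 0 + (2 * π * y) • horiz 1) *
        ((2 * π * (x - 1)) * (2 * π * (y - 1)))) (by fun_prop)
    simp only [res_apply, shift_apply, hsq]
    refine Eq.trans ?_ h.symm
    conv_lhs => rw [lineMean_reconstruct 0 f t]
    congr 1
    ext x
    rw [lineMean_reconstruct 1 f, lineMean_reconstruct 1 (pd 0 f),
      ← intervalIntegral.integral_const_mul, ← intervalIntegral.integral_add]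
    · congr 1
      ext y
      ring
    · exact Continuous.intervalIntegrable (by fun_prop) _ _
    · exact Continuous.intervalIntegrable (by fun_prop) _ _
  all_goals exact integrable_of_continuous (by fun_prop)

theorem eq_zero_of_lineMean_eq_zero {i : Fin 2} {f : PeriodicFunction} (hf : ∀ p, 0 ≤ f.1 p)
    {p : ℝ × ℝ × ℝ} (h : (lineMean i f).1 p = 0) : f.1 p = 0 := by
  by_contra hne
  refine (intervalIntegral.integral_pos (a := 0) (b := 1)
    (f := fun θ : ℝ => f.1 (p + (2 * π * θ) • horiz i)) one_pos
    (Continuous.continuousOn (by fun_prop)) (fun _ _ => hf _) ⟨0, by simp, ?_⟩).ne' h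
  simpa using (hf p).lt_of_ne' hne

theorem apply_eq_zero_of_mean_mul_self {f : PeriodicFunction} {t : ℝ × ℝ × ℝ}
    (hf : mean (shift t (f * f)) = 0) : f.1 t = 0 := by
  rw [mean_shift_eq_lineMean] at hf
  have hnn : ∀ p, 0 ≤ (f * f).1 p := fun p => mul_self_nonneg (f.1 p)
  exact mul_self_eq_zero.1 (eq_zero_of_lineMean_eq_zero hnn (eq_zero_of_lineMean_eq_zero
    (fun p => intervalIntegral.integral_nonneg zero_le_one fun _ _ => hnn _) hf))

end PeriodicFunction

section LaxMilgram

open scoped InnerProductSpace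

variable {E H : Type*} [NormedAddCommGroup E] [NormedSpace ℝ E]
  [NormedAddCommGroup H] [InnerProductSpace ℝ H]

/-- Smooth dependence on parameters of the solution in the Lax–Milgram theorem. -/
theorem exists_contDiff_laxMilgram (V : Submodule ℝ H) [CompleteSpace V]
    {T : E → H →L[ℝ] H} {F : E → H} (hT : ContDiff ℝ (⊤ : ℕ∞) T) (hF : ContDiff ℝ (⊤ : ℕ∞) F)
    {lam : ℝ} (hlam : 0 < lam) (hcoer : ∀ t, ∀ v ∈ V, lam * ‖v‖ ^ 2 ≤ ⟪T t v, v⟫_ℝ) :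
    ∃ v : E → H, ContDiff ℝ (⊤ : ℕ∞) v ∧
      ∀ t, v t ∈ V ∧ ∀ w ∈ V, ⟪T t (v t), w⟫_ℝ = ⟪F t, w⟫_ℝ := by
  let P : H →L[ℝ] V := V.orthogonalProjectionOnto
  let A : E → V →L[ℝ] V := fun t => P ∘L T t ∘L V.subtypeL
  have hA : ContDiff ℝ (⊤ : ℕ∞) A :=
    contDiff_const.clm_comp (hT.clm_comp contDiff_const)
  have hP : ∀ x : H, ∀ w : V, ⟪P x, w⟫_ℝ = ⟪x, (w : H)⟫_ℝ := fun x w =>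
    Submodule.inner_orthogonalProjectionOnto_eq_of_mem_right w x
  have hinv : ∀ t, (A t).IsInvertible := by
    intro t
    let B : V →L[ℝ] V →L[ℝ] ℝ := (innerSL ℝ) ∘L A t
    have hB : IsCoercive B := ⟨lam, hlam, fun u => by
      have := hcoer t u u.2
      rw [← hP] at this
      change lam * ‖u‖ * ‖u‖ ≤ ⟪P (T t u), u⟫_ℝ
      rw [mul_assoc, ← pow_two]
      exact this⟩
    refine ⟨hB.continuousLinearEquivOfBilin, ?_⟩
    ext1 v
    exact (hB.unique_continuousLinearEquivOfBilin fun w => rfl).symm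
  refine ⟨fun t => V.subtypeL ((A t).inverse (P (F t))), ?_, fun t => ⟨?_, fun w hw => ?_⟩⟩
  · refine V.subtypeL.contDiff.comp (ContDiff.clm_apply ?_ (P.contDiff.comp hF))
    rw [contDiff_iff_contDiffAt]
    exact fun t => (hinv t).contDiffAt_map_inverse.comp t hA.contDiffAt
  · exact Submodule.coe_mem _
  · have h : A t ((A t).inverse (P (F t))) = P (F t) := (hinv t).self_apply_inverse _
    rw [← hP (F t) ⟨w, hw⟩, ← h, ← hP _ ⟨w, hw⟩]
    rfl

end LaxMilgram

namespace PeriodicFunction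

open scoped InnerProductSpace

/-- The space of square integrable functions on the unit square. -/
abbrev L2 : Type := Lp ℝ 2 (volume : Measure UnitSquare)

/-- The space of square integrable plane vector fields on the unit square. -/
abbrev L2Field : Type := PiLp 2 (fun _ : Fin 2 => L2)

/-- The inclusion of continuous functions into the square integrable ones. -/
noncomputable def toL2 : C(UnitSquare, ℝ) →L[ℝ] L2 := ContinuousMap.toLp 2 volume ℝ

theorem inner_toL2 (a b : C(UnitSquare, ℝ)) : ⟪toL2 a, toL2 b⟫_ℝ = ∫ k, a k * b k := by
  refine (ContinuousMap.inner_toLp volume a b).trans ?_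
  simp [mul_comm]

theorem inner_toL2_res (f g : PeriodicFunction) : ⟪toL2 (res f), toL2 (res g)⟫_ℝ = mean (f * g) :=
  inner_toL2 _ _

/-- Multiplication of square integrable functions by continuous ones. -/
noncomputable def mulL2 : C(UnitSquare, ℝ) →L[ℝ] L2 →L[ℝ] L2 :=
  (ContinuousLinearMap.mul ℝ ℝ).holderL volume ⊤ 2 2 ∘L ContinuousMap.toLp ⊤ volume ℝ

theorem mulL2_toL2 (a b : C(UnitSquare, ℝ)) : mulL2 a (toL2 b) = toL2 (a * b) := by
  apply Lp.ext
  refine ((ContinuousLinearMap.mul ℝ ℝ).coeFn_holder _ _).trans ?_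
  filter_upwards [a.coeFn_toLp (p := ⊤) (𝕜 := ℝ) volume, b.coeFn_toLp (p := 2) (𝕜 := ℝ) volume,
    (a * b).coeFn_toLp (p := 2) (𝕜 := ℝ) volume] with k h1 h2 h3
  exact (congrArg₂ (· * ·) h1 h2).trans h3.symm

/-- Plane vector fields with components in `PeriodicFunction` as square integrable ones. -/
noncomputable def field : (Fin 2 → PeriodicFunction) →ₗ[ℝ] L2Field where
  toFun u := WithLp.toLp 2 fun i => toL2 (res (u i))
  map_add' u w := by ext1 i; simp
  map_smul' c u := by ext1 i; simp

theorem field_apply (u : Fin 2 → PeriodicFunction) (i : Fin 2) : field u i = toL2 (res (u i)) := rfl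

theorem inner_field (u w : Fin 2 → PeriodicFunction) :
    ⟪field u, field w⟫_ℝ = ∑ i, mean (u i * w i) := by
  simp [PiLp.inner_apply, field_apply, inner_toL2_res]

/-- The operator acting on vector fields through a matrix of continuous functions. -/
noncomputable def matrixOp (A : Fin 2 → Fin 2 → C(UnitSquare, ℝ)) : L2Field →L[ℝ] L2Field :=
  (PiLp.continuousLinearEquiv 2 ℝ (fun _ : Fin 2 => L2)).symm.toContinuousLinearMap ∘L
    ∑ i, ∑ j, ContinuousLinearMap.single ℝ (fun _ : Fin 2 => L2) i ∘L mulL2 (A i j) ∘L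
      PiLp.proj 2 (fun _ : Fin 2 => L2) j

theorem matrixOp_apply (A : Fin 2 → Fin 2 → C(UnitSquare, ℝ)) (v : L2Field) (i : Fin 2) :
    matrixOp A v i = ∑ j, mulL2 (A i j) (v j) := by
  simp [matrixOp, Fin.sum_univ_two]
  fin_cases i <;> simp

theorem matrixOp_field (a : Fin 2 → Fin 2 → PeriodicFunction) (u : Fin 2 → PeriodicFunction) :
    matrixOp (fun i j => res (a i j)) (field u) = field fun i => ∑ j, a i j * u j := by
  ext1 i
  rw [matrixOp_apply]
  simp only [field_apply, mulL2_toL2, map_sum, res_mul]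

/-- The gradient as a square integrable vector field. -/
noncomputable def grad : PeriodicFunction →ₗ[ℝ] L2Field := field ∘ₗ LinearMap.pi pd

theorem grad_eq_field (f : PeriodicFunction) : grad f = field fun i => pd i f := rfl

/-- The closure of the space of gradients. -/
noncomputable def gradients : Submodule ℝ L2Field := (LinearMap.range grad).topologicalClosure

instance : CompleteSpace gradients :=
  (Submodule.isClosed_topologicalClosure _).completeSpace_coe

theorem grad_mem_gradients (f : PeriodicFunction) : grad f ∈ gradients :=
  Submodule.le_topologicalClosure _ ⟨f, rfl⟩

theorem gradients_induction {p : L2Field → Prop} (hp : IsClosed {v | p v})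
    (h : ∀ f, p (grad f)) {v : L2Field} (hv : v ∈ gradients) : p v :=
  closure_minimal (s := Set.range grad) (by rintro _ ⟨f, rfl⟩; exact h f) hp hv

theorem norm_grad_shift (i : Fin 2) (r : ℝ) (f : PeriodicFunction) :
    ‖grad (shift (r • horiz i) f)‖ = ‖grad f‖ := by
  rw [norm_eq_sqrt_real_inner, norm_eq_sqrt_real_inner]
  simp only [grad_eq_field, inner_field, pd_shift, ← map_mul, mean_shift_smul]

/-- The coefficient operator of the translated problem. -/
noncomputable def coeffOp (a : Fin 2 → Fin 2 → PeriodicFunction) (t : ℝ × ℝ × ℝ) :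
    L2Field →L[ℝ] L2Field :=
  matrixOp fun i j => res (shift t (a i j))

theorem contDiff_coeffOp (a : Fin 2 → Fin 2 → PeriodicFunction) :
    ContDiff ℝ (⊤ : ℕ∞) (coeffOp a) := by
  refine contDiff_const.clm_comp (ContDiff.sum fun i _ => ContDiff.sum fun j _ =>
    contDiff_const.clm_comp (ContDiff.clm_comp ?_ contDiff_const))
  exact mulL2.contDiff.comp (contDiff_res_shift _)

theorem contDiff_field_shift (u : Fin 2 → PeriodicFunction) :
    ContDiff ℝ (⊤ : ℕ∞) fun t => field fun i => shift t (u i) := by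
  rw [contDiff_piLp]
  exact fun i => toL2.contDiff.comp (contDiff_res_shift _)

theorem inner_coeffOp_grad (a : Fin 2 → Fin 2 → PeriodicFunction) (t : ℝ × ℝ × ℝ)
    (f g : PeriodicFunction) : ⟪coeffOp a t (grad f), grad g⟫_ℝ =
      ∑ i, mean ((∑ j, shift t (a i j) * pd j f) * pd i g) := by
  rw [coeffOp, grad_eq_field, matrixOp_field, grad_eq_field, inner_field]

theorem mean_nonneg {f : PeriodicFunction} (hf : ∀ p, 0 ≤ f.1 p) : 0 ≤ mean f :=
  integral_nonneg fun _ => hf _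

/-- Uniform ellipticity with constant `lam`. -/
def IsElliptic (lam : ℝ) (a : Fin 2 → Fin 2 → PeriodicFunction) : Prop :=
  ∀ (ξ : Fin 2 → ℝ) p, lam * ∑ i, ξ i ^ 2 ≤ ∑ i, ∑ j, (a i j).1 p * ξ i * ξ j

theorem IsElliptic.coercive {lam : ℝ} {a : Fin 2 → Fin 2 → PeriodicFunction}
    (ha : IsElliptic lam a) (t : ℝ × ℝ × ℝ) {v : L2Field} (hv : v ∈ gradients) :
    lam * ‖v‖ ^ 2 ≤ ⟪coeffOp a t v, v⟫_ℝ := by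
  refine gradients_induction (p := fun v => lam * ‖v‖ ^ 2 ≤ ⟪coeffOp a t v, v⟫_ℝ)
    (isClosed_le (by fun_prop) (by fun_prop)) (fun f => ?_) hv
  rw [inner_coeffOp_grad, ← real_inner_self_eq_norm_sq, grad_eq_field, inner_field]
  simp only [← map_sum]
  rw [← smul_eq_mul, ← map_smul, ← sub_nonneg, ← map_sub]
  refine mean_nonneg fun p => ?_
  have h := ha (fun i => (pd i f).1 p) (p + t)
  simp only [Fin.sum_univ_two] at h ⊢
  change 0 ≤ ((shift t (a 0 0)).1 p * (pd 0 f).1 p + (shift t (a 0 1)).1 p * (pd 1 f).1 p) *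
    (pd 0 f).1 p + ((shift t (a 1 0)).1 p * (pd 0 f).1 p +
    (shift t (a 1 1)).1 p * (pd 1 f).1 p) * (pd 1 f).1 p -
    lam * ((pd 0 f).1 p * (pd 0 f).1 p + (pd 1 f).1 p * (pd 1 f).1 p)
  simp only [shift_apply]
  linarith

theorem IsElliptic.eq_zero {lam : ℝ} (hlam : 0 < lam) {a : Fin 2 → Fin 2 → PeriodicFunction}
    (ha : IsElliptic lam a) {t : ℝ × ℝ × ℝ} {v : L2Field} (hv : v ∈ gradients)
    (h : ∀ f, ⟪coeffOp a t v, grad f⟫_ℝ = 0) : v = 0 := by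
  have h1 : ⟪coeffOp a t v, v⟫_ℝ = 0 :=
    gradients_induction (p := fun w => ⟪coeffOp a t v, w⟫_ℝ = 0)
      (isClosed_eq (by fun_prop) (by fun_prop)) h hv
  have h2 := ha.coercive t hv
  rw [h1] at h2
  have h3 : ‖v‖ ^ 2 = 0 := le_antisymm (by nlinarith) (sq_nonneg _)
  simpa using h3

/-- A vector field in the closure of the gradients is a weak solution of the translated problem
`∂ᵢ(aᵢⱼ vⱼ) = ∂ᵢ σᵢ`. -/
def IsWeakSolution (a : Fin 2 → Fin 2 → PeriodicFunction) (σ : Fin 2 → PeriodicFunction)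
    (t : ℝ × ℝ × ℝ) (v : L2Field) : Prop :=
  v ∈ gradients ∧ ∀ f, ⟪coeffOp a t v, grad f⟫_ℝ = ⟪field fun i => shift t (σ i), grad f⟫_ℝ

section

variable {lam : ℝ} {a : Fin 2 → Fin 2 → PeriodicFunction} {σ : Fin 2 → PeriodicFunction}

theorem IsWeakSolution.unique (hlam : 0 < lam) (ha : IsElliptic lam a) {t : ℝ × ℝ × ℝ}
    {v w : L2Field} (hv : IsWeakSolution a σ t v) (hw : IsWeakSolution a σ t w) : v = w := by
  refine sub_eq_zero.1 (ha.eq_zero hlam (t := t) (gradients.sub_mem hv.1 hw.1) fun f => ?_)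
  rw [map_sub, inner_sub_left, hv.2, hw.2, sub_self]

theorem IsElliptic.exists_contDiff_isWeakSolution (hlam : 0 < lam) (ha : IsElliptic lam a)
    (σ : Fin 2 → PeriodicFunction) :
    ∃ v : ℝ × ℝ × ℝ → L2Field, ContDiff ℝ (⊤ : ℕ∞) v ∧ ∀ t, IsWeakSolution a σ t (v t) := by
  obtain ⟨v, hv, h⟩ := exists_contDiff_laxMilgram gradients (contDiff_coeffOp a)
    (contDiff_field_shift σ) hlam fun t v hv => ha.coercive t hv
  exact ⟨v, hv, fun t => ⟨(h t).1, fun f => (h t).2 _ (grad_mem_gradients f)⟩⟩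

theorem IsWeakSolution.norm_sub_grad_shift (hlam : 0 < lam) (ha : IsElliptic lam a)
    {t : ℝ × ℝ × ℝ} {v w : L2Field} {i : Fin 2} {r : ℝ} (hv : IsWeakSolution a σ t v)
    (hw : IsWeakSolution a σ (t + r • horiz i) w) (f : PeriodicFunction) :
    ‖w - grad (shift (r • horiz i) f)‖ = ‖v - grad f‖ := by
  obtain ⟨u, hu, hlim⟩ := mem_closure_iff_seq_limit.1 hv.1
  choose φ hφ using hu
  replace hφ : ∀ n, grad (φ n) = u n := hφ
  have hcauchy : CauchySeq fun n => grad (shift (r • horiz i) (φ n)) := by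
    have h := hlim.cauchySeq
    rw [Metric.cauchySeq_iff] at h ⊢
    refine fun ε hε => (h ε hε).imp fun N hN m hm n hn => ?_
    have := hN m hm n hn
    rwa [dist_eq_norm, ← hφ, ← hφ, ← map_sub, ← norm_grad_shift i r, map_sub, map_sub,
      ← dist_eq_norm] at this
  obtain ⟨w', hw'⟩ := cauchySeq_tendsto_of_complete hcauchy
  have hsol : IsWeakSolution a σ (t + r • horiz i) w' := by
    refine ⟨(Submodule.isClosed_topologicalClosure _).mem_of_tendsto hw'
      (.of_forall fun n => grad_mem_gradients _), fun g => ?_⟩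
    have h1 : ∀ n, ⟪coeffOp a (t + r • horiz i) (grad (shift (r • horiz i) (φ n))), grad g⟫_ℝ =
        ⟪coeffOp a t (u n), grad (shift ((-r) • horiz i) g)⟫_ℝ := by
      intro n
      rw [← hφ, inner_coeffOp_grad, inner_coeffOp_grad]
      refine Finset.sum_congr rfl fun k _ => ?_
      conv_rhs => rw [← mean_shift_smul i r]
      simp only [map_mul, map_sum, pd_shift, shift_shift, neg_smul, add_neg_cancel, shift_zero,
        add_comm t]
    have h2 := ((coeffOp a (t + r • horiz i)).continuous.tendsto w').comp hw'
    have h3 := ((coeffOp a t).continuous.tendsto v).comp hlim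
    have h4 := Filter.Tendsto.inner (𝕜 := ℝ) h2 (tendsto_const_nhds (x := grad g))
    have h5 := Filter.Tendsto.inner (𝕜 := ℝ) h3 (tendsto_const_nhds (x := grad (shift ((-r) • horiz i) g)))
    simp only [Function.comp_def, h1] at h4 h5
    rw [tendsto_nhds_unique h4 h5, hv.2, grad_eq_field, grad_eq_field, inner_field, inner_field]
    refine Finset.sum_congr rfl fun k _ => ?_
    conv_lhs => rw [← mean_shift_smul i r]
    simp only [map_mul, pd_shift, shift_shift, neg_smul, add_neg_cancel, shift_zero, add_comm t]
  obtain rfl := hsol.unique hlam ha hw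
  refine tendsto_nhds_unique ((hw'.sub_const _).norm) ?_
  refine ((hlim.sub_const (grad f)).norm).congr fun n => ?_
  rw [← hφ, ← map_sub, ← map_sub, ← map_sub, norm_grad_shift]

end

/-- The pairing of a smooth periodic family of vector fields with a fixed one. -/
noncomputable def pairing (c : L2Field) (v : ℝ × ℝ × ℝ → L2Field)
    (hv : ContDiff ℝ (⊤ : ℕ∞) v) (hper : ∀ i p, v (p + (2 * π) • horiz i) = v p) :
    PeriodicFunction :=
  ⟨fun t => ⟪c, v t⟫_ℝ, contDiff_const.inner ℝ hv, fun i p => by simp only [hper]⟩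

/-- The vector field of weights of the first derivatives in `reconstruct`. -/
noncomputable def gradWeight : L2Field := WithLp.toLp 2 fun i => toL2 (weight i)

/-- The vector field of weights of the mixed derivative in `reconstruct`. -/
noncomputable def mixedWeight : L2Field := WithLp.toLp 2 ![toL2 (weight 0 * weight 1), 0]

/-- The function with mean zero reconstructed from a family of translates of its gradient. -/
noncomputable def potential (v : ℝ × ℝ × ℝ → L2Field)
    (hv : ContDiff ℝ (⊤ : ℕ∞) v) (hper : ∀ i p, v (p + (2 * π) • horiz i) = v p) :
    PeriodicFunction :=
  pairing gradWeight v hv hper + pd 1 (pairing mixedWeight v hv hper)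

theorem shift_two_pi (i : Fin 2) (p : ℝ × ℝ × ℝ) (f : PeriodicFunction) :
    shift (p + (2 * π) • horiz i) f = shift p f := by
  ext q
  rw [shift_apply, shift_apply, ← add_assoc, f.periodic]

theorem contDiff_grad_shift (f : PeriodicFunction) :
    ContDiff ℝ (⊤ : ℕ∞) fun t => grad (shift t f) := by
  simp only [grad_eq_field, pd_shift]
  exact contDiff_field_shift _

theorem potential_grad_apply (f : PeriodicFunction) (t : ℝ × ℝ × ℝ) :
    (potential (fun t => grad (shift t f)) (contDiff_grad_shift f)
      (fun i p => by rw [shift_two_pi])).1 t = f.1 t - mean (shift t f) := by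
  have h1 : ∀ s, (pairing mixedWeight (fun t => grad (shift t f)) (contDiff_grad_shift f)
      (fun i p => by rw [shift_two_pi])).1 s =
      ⟪toL2 (weight 0 * weight 1), toL2 (res (shift s (pd 0 f)))⟫_ℝ := by
    intro s
    simp [pairing, mixedWeight, PiLp.inner_apply, grad_eq_field, field_apply, pd_shift]
  have h2 : HasFDerivAt (fun s => ⟪toL2 (weight 0 * weight 1), toL2 (res (shift s (pd 0 f)))⟫_ℝ)
      ((innerSL ℝ (toL2 (weight 0 * weight 1)) ∘L toL2) ∘L
        fderiv ℝ (fun s => res (shift s (pd 0 f))) t) t :=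
    (innerSL ℝ (toL2 (weight 0 * weight 1)) ∘L toL2).hasFDerivAt.comp t
      ((contDiff_res_shift (pd 0 f)).differentiable (by simp) t).hasFDerivAt
  change ⟪gradWeight, grad (shift t f)⟫_ℝ + fderiv ℝ (pairing mixedWeight _ _ _).1 t (horiz 1) = _
  rw [funext h1, h2.fderiv]
  simp only [ContinuousLinearMap.comp_apply, fderiv_res_shift, innerSL_apply_apply, inner_toL2]
  rw [reconstruct f t]
  simp only [gradWeight, PiLp.inner_apply, grad_eq_field, field_apply, pd_shift, inner_toL2,
    Fin.sum_univ_two, mul_comm (weight _ _), mul_comm ((weight 0 * weight 1) _)]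
  ring

theorem abs_mean_mul_le {f : PeriodicFunction} {C : ℝ} (hf : ∀ k, |f.1 (square k)| ≤ C)
    (χ : PeriodicFunction) : |mean (f * χ)| ≤ C * ‖res χ‖ := by
  have h := norm_integral_le_of_norm_le_const (μ := (volume : Measure UnitSquare))
    (f := fun k => (f * χ).1 (square k)) (C := C * ‖res χ‖) (.of_forall fun k => by
      change ‖f.1 (square k) * (res χ) k‖ ≤ _
      rw [norm_mul]
      exact mul_le_mul (hf k) ((res χ).norm_coe_le_norm k) (norm_nonneg _)
        ((abs_nonneg _).trans (hf k)))
  simpa [mean_apply] using h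

section

variable {lam : ℝ} {a : Fin 2 → Fin 2 → PeriodicFunction} {σ : Fin 2 → PeriodicFunction}
  {v : ℝ × ℝ × ℝ → L2Field}

theorem norm_sub_grad_shift_square (hlam : 0 < lam) (ha : IsElliptic lam a)
    (h : ∀ t, IsWeakSolution a σ t (v t)) (t : ℝ × ℝ × ℝ) (f : PeriodicFunction)
    (k : UnitSquare) : ‖v (square k + t) - grad (shift (square k) f)‖ = ‖v t - grad f‖ := by
  have h1 : square k + t = t + (2 * π * (k.1 : ℝ)) • horiz 0 + (2 * π * (k.2 : ℝ)) • horiz 1 := by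
    change _ + _ + t = _
    abel
  have h2 : shift (square k) f =
      shift ((2 * π * (k.2 : ℝ)) • horiz 1) (shift ((2 * π * (k.1 : ℝ)) • horiz 0) f) := by
    rw [shift_shift, add_comm]; rfl
  rw [h1, h2, (h (t + _)).norm_sub_grad_shift hlam ha (h _), (h t).norm_sub_grad_shift hlam ha (h _)]

theorem IsWeakSolution.add_two_pi (hlam : 0 < lam) (ha : IsElliptic lam a)
    (h : ∀ t, IsWeakSolution a σ t (v t)) (i : Fin 2) (p : ℝ × ℝ × ℝ) :
    v (p + (2 * π) • horiz i) = v p := by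
  refine IsWeakSolution.unique (σ := σ) hlam ha (t := p) ?_ (h p)
  have := h (p + (2 * π) • horiz i)
  simpa only [IsWeakSolution, coeffOp, shift_two_pi] using this

theorem exists_abs_mean_potential_mul_sub_le (hlam : 0 < lam) (ha : IsElliptic lam a)
    (hv : ContDiff ℝ (⊤ : ℕ∞) v) (hper : ∀ i p, v (p + (2 * π) • horiz i) = v p)
    (h : ∀ t, IsWeakSolution a σ t (v t)) (t : ℝ × ℝ × ℝ) (χ : PeriodicFunction) :
    ∃ C, ∀ f, |mean (shift t (potential v hv hper) * χ) - (mean (f * χ) - mean f * mean χ)| ≤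
      C * ‖v t - grad f‖ := by
  refine ⟨‖gradWeight‖ * ‖res χ‖ + ‖mixedWeight‖ * ‖res (pd 1 χ)‖, fun f => ?_⟩
  have hgrad := contDiff_grad_shift f
  have hgper : ∀ i p, grad (shift (p + (2 * π) • horiz i) f) = grad (shift p f) :=
    fun i p => by rw [shift_two_pi]
  let d : L2Field → PeriodicFunction := fun c =>
    shift t (pairing c v hv hper) - pairing c (fun t => grad (shift t f)) hgrad hgper
  have hd : ∀ c k, |(d c).1 (square k)| ≤ ‖c‖ * ‖v t - grad f‖ := by
    intro c k
    change |⟪c, v (square k + t)⟫_ℝ - ⟪c, grad (shift (square k) f)⟫_ℝ| ≤ _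
    rw [← inner_sub_right, ← norm_sub_grad_shift_square hlam ha h t f k]
    exact abs_real_inner_le_norm _ _
  have h1 : shift t (potential v hv hper) =
      potential (fun t => grad (shift t f)) hgrad hgper + (d gradWeight + pd 1 (d mixedWeight)) := by
    simp only [d, potential, map_add, map_sub, pd_shift]
    abel
  have h2 : mean (potential (fun t => grad (shift t f)) hgrad hgper * χ) =
      mean (f * χ) - mean f * mean χ := by
    rw [← smul_eq_mul (mean f), ← map_smul, ← map_sub]
    refine integral_congr_ae (.of_forall fun k => ?_)
    change (potential (fun t => grad (shift t f)) hgrad hgper).1 (square k) * χ.1 (square k) =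
      f.1 (square k) * χ.1 (square k) - mean f * χ.1 (square k)
    rw [potential_grad_apply, mean_shift_square]
    ring
  have h3 : mean (pd 1 (d mixedWeight) * χ) = - mean (d mixedWeight * pd 1 χ) := by
    rw [mean_mul_pd, neg_neg]
  rw [h1, add_mul, map_add, h2, add_mul, map_add, h3, add_sub_cancel_left, ← sub_eq_add_neg]
  refine (abs_sub _ _).trans ?_
  have h4 := abs_mean_mul_le (hd gradWeight) χ
  have h5 := abs_mean_mul_le (hd mixedWeight) (pd 1 χ)
  linarith

theorem mean_shift_potential (hlam : 0 < lam) (ha : IsElliptic lam a)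
    (hv : ContDiff ℝ (⊤ : ℕ∞) v) (hper : ∀ i p, v (p + (2 * π) • horiz i) = v p)
    (h : ∀ t, IsWeakSolution a σ t (v t)) (t : ℝ × ℝ × ℝ) :
    mean (shift t (potential v hv hper)) = 0 := by
  obtain ⟨C, hC⟩ := exists_abs_mean_potential_mul_sub_le hlam ha hv hper h t 1
  have h1 : mean 1 = 1 := by
    rw [mean_apply]
    change ∫ _ : UnitSquare, (1 : ℝ) = 1
    simp
  have h2 := gradients_induction
    (p := fun w => |mean (shift t (potential v hv hper))| ≤ C * ‖v t - w‖)
    (isClosed_le (by fun_prop) (by fun_prop))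
    (fun f => by simpa [h1] using hC f) (h t).1
  simpa using h2

theorem mean_shift_pd_potential_mul (hlam : 0 < lam) (ha : IsElliptic lam a)
    (hv : ContDiff ℝ (⊤ : ℕ∞) v) (hper : ∀ i p, v (p + (2 * π) • horiz i) = v p)
    (h : ∀ t, IsWeakSolution a σ t (v t)) (t : ℝ × ℝ × ℝ) (i : Fin 2) (χ : PeriodicFunction) :
    mean (shift t (pd i (potential v hv hper)) * χ) = ⟪v t i, toL2 (res χ)⟫_ℝ := by
  obtain ⟨C, hC⟩ := exists_abs_mean_potential_mul_sub_le hlam ha hv hper h t (pd i χ)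
  have h2 := gradients_induction
    (p := fun w => |mean (shift t (pd i (potential v hv hper)) * χ) - ⟪w i, toL2 (res χ)⟫_ℝ| ≤
      C * ‖v t - w‖)
    (isClosed_le (by fun_prop) (by fun_prop))
    (fun f => by
      have h3 := hC f
      rw [mean_mul_pd, mean_mul_pd, mean_pd, pd_shift, mul_zero, sub_zero, ← neg_sub', abs_neg] at h3
      rwa [grad_eq_field, field_apply, inner_toL2_res]) (h t).1
  simpa [sub_eq_zero] using h2

theorem inner_coeffOp_grad_of_mem (t : ℝ × ℝ × ℝ) {w : L2Field} (hw : w ∈ gradients)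
    (χ : PeriodicFunction) : ⟪coeffOp a t w, grad χ⟫_ℝ =
      ∑ i, ∑ j, ⟪w j, toL2 (res (shift t (a i j) * pd i χ))⟫_ℝ := by
  refine gradients_induction (p := fun w => ⟪coeffOp a t w, grad χ⟫_ℝ =
    ∑ i, ∑ j, ⟪w j, toL2 (res (shift t (a i j) * pd i χ))⟫_ℝ)
    (isClosed_eq (by fun_prop) (by fun_prop)) (fun f => ?_) hw
  rw [inner_coeffOp_grad]
  simp only [grad_eq_field, field_apply, inner_toL2_res, Finset.sum_mul, map_sum]
  refine Finset.sum_congr rfl fun i _ => Finset.sum_congr rfl fun j _ => ?_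
  congr 1
  ring

/-- The second order operator in divergence form with coefficients `a`. -/
noncomputable def divGrad (a : Fin 2 → Fin 2 → PeriodicFunction) (f : PeriodicFunction) :
    PeriodicFunction := ∑ i, pd i (∑ j, a i j * pd j f)

theorem divGrad_sub (a : Fin 2 → Fin 2 → PeriodicFunction) (f g : PeriodicFunction) :
    divGrad a (f - g) = divGrad a f - divGrad a g := by
  simp [divGrad, mul_sub]

theorem mean_shift_divergence_mul (u : Fin 2 → PeriodicFunction) (t : ℝ × ℝ × ℝ)
    (χ : PeriodicFunction) : mean (shift t (∑ i, pd i (u i)) * χ) =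
      - ∑ i, mean (shift t (u i) * pd i χ) := by
  simp only [map_sum, Finset.sum_mul, mean_mul_pd, pd_shift, Finset.sum_neg_distrib, neg_neg]

theorem divGrad_potential (hlam : 0 < lam) (ha : IsElliptic lam a)
    (hv : ContDiff ℝ (⊤ : ℕ∞) v) (hper : ∀ i p, v (p + (2 * π) • horiz i) = v p)
    (h : ∀ t, IsWeakSolution a σ t (v t)) : divGrad a (potential v hv hper) = ∑ i, pd i (σ i) := by
  have h1 : ∀ t χ, mean (shift t (divGrad a (potential v hv hper) - ∑ i, pd i (σ i)) * χ) = 0 := by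
    intro t χ
    rw [map_sub, sub_mul, map_sub, divGrad, mean_shift_divergence_mul, mean_shift_divergence_mul,
      sub_eq_zero, neg_inj]
    have h2 := (h t).2 χ
    rw [inner_coeffOp_grad_of_mem t (h t).1, grad_eq_field, inner_field] at h2
    rw [← h2]
    refine Finset.sum_congr rfl fun i _ => ?_
    rw [map_sum, Finset.sum_mul, map_sum]
    refine Finset.sum_congr rfl fun j _ => ?_
    rw [← mean_shift_pd_potential_mul hlam ha hv hper h, map_mul (shift t)]
    congr 1
    ring
  refine sub_eq_zero.1 (Subtype.ext (funext fun t => apply_eq_zero_of_mean_mul_self ?_))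
  rw [map_mul]
  exact h1 t _

theorem IsElliptic.exists_divGrad_eq (hlam : 0 < lam) (ha : IsElliptic lam a)
    (S : PeriodicFunction) (hS : ∀ t, mean (shift t S) = 0) :
    ∃ ρ, divGrad a ρ = S ∧ ∀ t, mean (shift t ρ) = 0 := by
  obtain ⟨σ, rfl⟩ := exists_divergence_eq S hS
  obtain ⟨v, hv, h⟩ := ha.exists_contDiff_isWeakSolution hlam σ
  exact ⟨potential v hv (IsWeakSolution.add_two_pi hlam ha h), divGrad_potential hlam ha hv _ h,
    mean_shift_potential hlam ha hv _ h⟩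

theorem IsElliptic.eq_zero_of_divGrad_eq_zero (hlam : 0 < lam) (ha : IsElliptic lam a)
    {f : PeriodicFunction} (hf : divGrad a f = 0) (hmean : ∀ t, mean (shift t f) = 0) : f = 0 := by
  have hpd : ∀ i, pd i f = 0 := by
    intro i
    refine Subtype.ext (funext fun t => apply_eq_zero_of_mean_mul_self ?_)
    have h1 := mean_shift_divergence_mul (fun i => ∑ j, a i j * pd j f) t (shift t f)
    change mean (shift t (divGrad a f) * _) = _ at h1
    rw [hf, map_zero, zero_mul, map_zero, zero_eq_neg] at h1
    simp only [pd_shift, ← map_mul, ← map_sum] at h1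
    have h2 : 0 ≤ mean (shift t (∑ i, (∑ j, a i j * pd j f) * pd i f -
        lam • ∑ i, pd i f * pd i f)) := by
      refine mean_nonneg fun p => ?_
      have h := ha (fun i => (pd i f).1 (p + t)) (p + t)
      simp only [Fin.sum_univ_two] at h ⊢
      change 0 ≤ ((a 0 0).1 (p + t) * (pd 0 f).1 (p + t) + (a 0 1).1 (p + t) *
        (pd 1 f).1 (p + t)) * (pd 0 f).1 (p + t) + ((a 1 0).1 (p + t) * (pd 0 f).1 (p + t) +
        (a 1 1).1 (p + t) * (pd 1 f).1 (p + t)) * (pd 1 f).1 (p + t) -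
        lam * ((pd 0 f).1 (p + t) * (pd 0 f).1 (p + t) + (pd 1 f).1 (p + t) * (pd 1 f).1 (p + t))
      linarith
    have h3 : ∀ j, 0 ≤ mean (shift t (pd j f * pd j f)) :=
      fun j => mean_nonneg fun p => mul_self_nonneg _
    rw [map_sub, map_sub, h1, map_smul, map_smul, smul_eq_mul, map_sum, map_sum] at h2
    have h4 : ∑ j, mean (shift t (pd j f * pd j f)) = 0 :=
      le_antisymm (by nlinarith) (Finset.sum_nonneg fun j _ => h3 j)
    exact (Finset.sum_eq_zero_iff_of_nonneg fun j _ => h3 j).1 h4 i (Finset.mem_univ i)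
  ext t
  rw [reconstruct f t, hmean, hpd 0, hpd 1, map_zero, map_zero, map_zero]
  simp

end

end PeriodicFunction

theorem add_smul_horiz_zero (p : ℝ × ℝ × ℝ) (r : ℝ) :
    p + r • horiz 0 = (p.1 + r, p.2.1, p.2.2) := by
  ext <;> simp [horiz]

theorem add_smul_horiz_one (p : ℝ × ℝ × ℝ) (r : ℝ) :
    p + r • horiz 1 = (p.1, p.2.1 + r, p.2.2) := by
  ext <;> simp [horiz]

theorem pdi_apply (i : Fin 2) (f : ℝ × ℝ × ℝ → ℝ) (p : ℝ × ℝ × ℝ) :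
    pdi i f p = fderiv ℝ f p (horiz i) := by
  fin_cases i <;> rfl

/-- An open interval of real numbers is the image of a smooth parametrization by the real line. -/
theorem exists_smooth_parametrization_Ioo {c d : ℝ} (hcd : c < d) :
    ∃ e : OpenPartialHomeomorph ℝ ℝ, e.source = Set.univ ∧ e.target = Set.Ioo c d ∧
      ContDiff ℝ (⊤ : ℕ∞) e ∧ ContDiffOn ℝ (⊤ : ℕ∞) e.symm e.target := by
  have hr : 0 < (d - c) / 2 := by linarith
  refine ⟨OpenPartialHomeomorph.univBall ((c + d) / 2) ((d - c) / 2),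
    OpenPartialHomeomorph.univBall_source _ _, ?_, OpenPartialHomeomorph.contDiff_univBall, ?_⟩
  · rw [OpenPartialHomeomorph.univBall_target _ hr, Real.Ioo_eq_ball]
  · rw [OpenPartialHomeomorph.univBall_target _ hr]
    exact OpenPartialHomeomorph.contDiffOn_univBall_symm

namespace PeriodicFunction

/-- The set of points whose third coordinate lies in `U`. -/
def region (U : Set ℝ) : Set (ℝ × ℝ × ℝ) := {p | p.2.2 ∈ U}

theorem isOpen_region {U : Set ℝ} (hU : IsOpen U) : IsOpen (region U) :=
  hU.preimage (continuous_snd.comp continuous_snd)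

/-- A function on the region, in terms of the parameter. -/
def pull (e : OpenPartialHomeomorph ℝ ℝ) (f : ℝ × ℝ × ℝ → ℝ) (p : ℝ × ℝ × ℝ) : ℝ :=
  f (p.1, p.2.1, e p.2.2)

/-- A function of the parameter, as a function on the region. -/
noncomputable def push (e : OpenPartialHomeomorph ℝ ℝ) (f : PeriodicFunction) (p : ℝ × ℝ × ℝ) : ℝ :=
  f.1 (p.1, p.2.1, e.symm p.2.2)

section

variable {e : OpenPartialHomeomorph ℝ ℝ}

theorem pull_mem (hsource : e.source = Set.univ) (he : ContDiff ℝ (⊤ : ℕ∞) e)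
    {f : ℝ × ℝ × ℝ → ℝ} (hf : ContDiffOn ℝ (⊤ : ℕ∞) f (region e.target))
    (h₁ : ∀ p : ℝ × ℝ × ℝ, f (p.1 + 2 * π, p.2.1, p.2.2) = f p)
    (h₂ : ∀ p : ℝ × ℝ × ℝ, f (p.1, p.2.1 + 2 * π, p.2.2) = f p) : pull e f ∈ smoothPeriodic := by
  refine ⟨?_, fun i p => ?_⟩
  · rw [← contDiffOn_univ]
    refine hf.comp (g := f) (f := fun p : ℝ × ℝ × ℝ => (p.1, p.2.1, e p.2.2))
      (ContDiff.contDiffOn ?_) fun p _ => e.map_source (by simp [hsource])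
    exact contDiff_fst.prodMk ((contDiff_fst.comp contDiff_snd).prodMk
      (he.comp (contDiff_snd.comp contDiff_snd)))
  · fin_cases i
    · exact (congrArg (pull e f) (add_smul_horiz_zero p _)).trans (h₁ (p.1, p.2.1, e p.2.2))
    · exact (congrArg (pull e f) (add_smul_horiz_one p _)).trans (h₂ (p.1, p.2.1, e p.2.2))

theorem push_pull {f : ℝ × ℝ × ℝ → ℝ} (hf : pull e f ∈ smoothPeriodic) :
    Set.EqOn f (push e ⟨pull e f, hf⟩) (region e.target) := by
  intro p hp
  change f p = f (p.1, p.2.1, e (e.symm p.2.2))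
  rw [e.right_inv hp]

theorem push_apply (hsource : e.source = Set.univ) (f : PeriodicFunction) (p : ℝ × ℝ × ℝ) :
    push e f (p.1, p.2.1, e p.2.2) = f.1 p := by
  change f.1 (p.1, p.2.1, e.symm (e p.2.2)) = f.1 p
  rw [e.left_inv (by simp [hsource])]

theorem contDiffOn_push (hsymm : ContDiffOn ℝ (⊤ : ℕ∞) e.symm e.target) (f : PeriodicFunction) :
    ContDiffOn ℝ (⊤ : ℕ∞) (push e f) (region e.target) :=
  f.contDiff.comp_contDiffOn (contDiff_fst.contDiffOn.prodMk
    ((contDiff_fst.comp contDiff_snd).contDiffOn.prodMk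
      (hsymm.comp (contDiff_snd.comp contDiff_snd).contDiffOn fun _ hp => hp)))

theorem push_add_smul_horiz (f : PeriodicFunction) (p : ℝ × ℝ × ℝ) (i : Fin 2) (r : ℝ) :
    push e f (p + r • horiz i) = f.1 ((p.1, p.2.1, e.symm p.2.2) + r • horiz i) := by
  fin_cases i
  · simp [add_smul_horiz_zero, push]
  · simp [add_smul_horiz_one, push]

theorem push_add_two_pi (f : PeriodicFunction) (p : ℝ × ℝ × ℝ) (i : Fin 2) :
    push e f (p + (2 * π) • horiz i) = push e f p := by
  rw [push_add_smul_horiz, f.periodic]; rfl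

theorem pdi_eq_push (hsymm : ContDiffOn ℝ (⊤ : ℕ∞) e.symm e.target) {f : PeriodicFunction}
    {g : ℝ × ℝ × ℝ → ℝ} (hg : Set.EqOn g (push e f) (region e.target)) (i : Fin 2) :
    Set.EqOn (pdi i g) (push e (pd i f)) (region e.target) := by
  intro p hp
  have hnhds := (isOpen_region e.open_target).mem_nhds hp
  have h1 : DifferentiableAt ℝ (push e f) p :=
    ((contDiffOn_push hsymm f).differentiableOn (by simp)).differentiableAt hnhds
  rw [pdi_apply, (hg.eventuallyEq_of_mem hnhds).fderiv_eq, ← h1.lineDeriv_eq_fderiv]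
  change _ = fderiv ℝ f.1 _ _
  rw [← (f.differentiable _).lineDeriv_eq_fderiv]
  simp only [lineDeriv, push_add_smul_horiz]

theorem sum_pdi_eq_push (hsymm : ContDiffOn ℝ (⊤ : ℕ∞) e.symm e.target)
    {a : Fin 2 → Fin 2 → PeriodicFunction} {α : Fin 2 → Fin 2 → ℝ × ℝ × ℝ → ℝ}
    (hα : ∀ i j, Set.EqOn (α i j) (push e (a i j)) (region e.target)) {f : PeriodicFunction}
    {g : ℝ × ℝ × ℝ → ℝ} (hg : Set.EqOn g (push e f) (region e.target)) :
    Set.EqOn (fun p => ∑ i, pdi i (fun q => ∑ j, α i j q * pdi j g q) p) (push e (divGrad a f))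
      (region e.target) := by
  intro p hp
  have h1 : ∀ i, Set.EqOn (fun q => ∑ j, α i j q * pdi j g q) (push e (∑ j, a i j * pd j f))
      (region e.target) := by
    intro i q hq
    simp only [Fin.sum_univ_two, hα _ _ hq, pdi_eq_push hsymm hg _ hq]
    rfl
  have h2 := fun i => pdi_eq_push hsymm (h1 i) i hp
  rw [divGrad, Fin.sum_univ_two]
  exact (Fin.sum_univ_two _).trans (congrArg₂ (· + ·) (h2 0) (h2 1))

theorem setIntegral_eq_mean (f : PeriodicFunction) (t : ℝ) :
    ∫ q in Set.Ioo (0 : ℝ) (2 * π) ×ˢ Set.Ioo (0 : ℝ) (2 * π), f.1 (q.1, q.2, t) =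
      (2 * π) ^ 2 * mean (shift (0, 0, t) f) := by
  have hcont : Continuous fun q : ℝ × ℝ => f.1 (q.1, q.2, t) := by fun_prop
  have h := integral_square (fun x y => f.1 (2 * π * x, 2 * π * y, t)) (by fun_prop)
  have h' : mean (shift (0, 0, t) f) = ∫ k : UnitSquare, f.1 (2 * π * k.1, 2 * π * k.2, t) := by
    refine integral_congr_ae (.of_forall fun k => congrArg f.1 ?_)
    change (2 * π * (k.1 : ℝ)) • horiz 0 + (2 * π * (k.2 : ℝ)) • horiz 1 + (0, 0, t) = _
    ext <;> simp [horiz]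
  rw [h', h, Measure.volume_eq_prod, setIntegral_prod]
  · have hπ : (0 : ℝ) ≤ 2 * π := by positivity
    simp only [← integral_Ioc_eq_integral_Ioo, ← intervalIntegral.integral_of_le hπ]
    have h1 : ∀ g : ℝ → ℝ, ∫ x in (0 : ℝ)..2 * π, g x =
        2 * π * ∫ x in (0 : ℝ)..1, g (2 * π * x) := by
      intro g
      simpa using (intervalIntegral.smul_integral_comp_mul_left (a := 0) (b := 1) g (2 * π)).symm
    rw [h1]
    simp only [fun x => h1 fun y => f.1 (x, y, t)]
    rw [intervalIntegral.integral_const_mul]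
    ring
  · rw [← Measure.volume_eq_prod]
    exact (hcont.continuousOn.integrableOn_compact (isCompact_Icc.prod isCompact_Icc)).mono_set
      (Set.prod_mono Set.Ioo_subset_Icc_self Set.Ioo_subset_Icc_self)

theorem mean_shift_height (f : PeriodicFunction) (p : ℝ × ℝ × ℝ) :
    mean (shift p f) = mean (shift (0, 0, p.2.2) f) := by
  have h : p = p.1 • horiz 0 + (p.2.1 • horiz 1 + (0, 0, p.2.2)) := by
    ext <;> simp [horiz]
  conv_lhs => rw [h]
  rw [← shift_shift, ← shift_shift, mean_shift_smul, mean_shift_smul]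

theorem forall_setIntegral_eq_zero_iff (hsource : e.source = Set.univ) {f : PeriodicFunction}
    {g : ℝ × ℝ × ℝ → ℝ} (hg : Set.EqOn g (push e f) (region e.target)) :
    (∀ Ψ ∈ e.target, ∫ q in Set.Ioo (0 : ℝ) (2 * π) ×ˢ Set.Ioo (0 : ℝ) (2 * π),
      g (q.1, q.2, Ψ) = 0) ↔ ∀ t, mean (shift t f) = 0 := by
  have h : ∀ Ψ ∈ e.target, ∫ q in Set.Ioo (0 : ℝ) (2 * π) ×ˢ Set.Ioo (0 : ℝ) (2 * π),
      g (q.1, q.2, Ψ) = (2 * π) ^ 2 * mean (shift (0, 0, e.symm Ψ) f) := by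
    intro Ψ hΨ
    rw [← setIntegral_eq_mean]
    congr 1
    ext q
    exact hg (x := (q.1, q.2, Ψ)) hΨ
  have hπ : (2 * π) ^ 2 ≠ 0 := by positivity
  refine ⟨fun h0 t => ?_, fun h0 Ψ hΨ => by rw [h Ψ hΨ, h0, mul_zero]⟩
  have hs : t.2.2 ∈ e.source := by simp [hsource]
  have h1 := h0 _ (e.map_source hs)
  rw [h _ (e.map_source hs), e.left_inv hs] at h1
  rw [mean_shift_height]
  exact (mul_eq_zero.1 h1).resolve_left hπ

/-- Reduction of a point to the fundamental period cell. -/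
theorem exists_mem_cell (p : ℝ × ℝ × ℝ) : ∃ μ ∈ Set.Ico 0 (2 * π), ∃ ν ∈ Set.Ico 0 (2 * π),
    ∀ f : PeriodicFunction, f.1 p = f.1 (μ, ν, p.2.2) := by
  refine ⟨toIcoMod Real.two_pi_pos 0 p.1, by simpa using toIcoMod_mem_Ico Real.two_pi_pos 0 p.1,
    toIcoMod Real.two_pi_pos 0 p.2.1, by simpa using toIcoMod_mem_Ico Real.two_pi_pos 0 p.2.1,
    fun f => ?_⟩
  have h0 : ∀ y z, Function.Periodic (fun x => f.1 (x, y, z)) (2 * π) := fun y z x => by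
    simpa [add_smul_horiz_zero] using f.periodic 0 (x, y, z)
  have h1 : ∀ x z, Function.Periodic (fun y => f.1 (x, y, z)) (2 * π) := fun x z y => by
    simpa [add_smul_horiz_one] using f.periodic 1 (x, y, z)
  exact (((h0 _ _).sub_zsmul_eq _).trans ((h1 _ _).sub_zsmul_eq _)).symm

end

end PeriodicFunction

open PeriodicFunction

/-- for smooth doubly `2π`-periodic coefficients `α^{ij}` (symmetric and uniformly
strictly elliptic on each level of the parameter `Ψ ∈ U`) and a smooth doubly `2π`-periodic
source `S` with zero mean over `D = (0,2π)²` for each `Ψ ∈ U`, the divergence-form equation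
`∂/∂x^i (α^{ij} ∂ρ/∂x^j) = S` admits a unique smooth doubly `2π`-periodic solution `ρ` on
`ℝ² × U` with zero mean over `D` for each `Ψ ∈ U`. -/
theorem periodic_elliptic_solvability
    (U : Set ℝ) (hUopen : IsOpen U) (hUbdd : Bornology.IsBounded U)
    (hUint : ∃ c d : ℝ, c < d ∧ U = Set.Ioo c d)
    (α : Fin 2 → Fin 2 → ℝ × ℝ × ℝ → ℝ) (S : ℝ × ℝ × ℝ → ℝ)
    (hα : ∀ i j : Fin 2, ContDiffOn ℝ (⊤ : ℕ∞) (α i j) {p : ℝ × ℝ × ℝ | p.2.2 ∈ U})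
    (hS : ContDiffOn ℝ (⊤ : ℕ∞) S {p : ℝ × ℝ × ℝ | p.2.2 ∈ U})
    (hsym : ∀ (i j : Fin 2) (p : ℝ × ℝ × ℝ), α i j p = α j i p)
    (hαper₁ : ∀ (i j : Fin 2) (p : ℝ × ℝ × ℝ), α i j (p.1 + 2 * π, p.2.1, p.2.2) = α i j p)
    (hαper₂ : ∀ (i j : Fin 2) (p : ℝ × ℝ × ℝ), α i j (p.1, p.2.1 + 2 * π, p.2.2) = α i j p)
    (hSper₁ : ∀ p : ℝ × ℝ × ℝ, S (p.1 + 2 * π, p.2.1, p.2.2) = S p)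
    (hSper₂ : ∀ p : ℝ × ℝ × ℝ, S (p.1, p.2.1 + 2 * π, p.2.2) = S p)
    (hSmean : ∀ Ψ ∈ U, ∫ q in Set.Ioo (0:ℝ) (2*π) ×ˢ Set.Ioo (0:ℝ) (2*π), S (q.1, q.2, Ψ) = 0)
    (lam : ℝ) (hlam : 0 < lam)
    (hell : ∀ (ξ : Fin 2 → ℝ) (μ ν : ℝ), μ ∈ Set.Ico 0 (2*π) → ν ∈ Set.Ico 0 (2*π) → ∀ Ψ ∈ U,
      lam * (ξ 0 ^ 2 + ξ 1 ^ 2) ≤ ∑ i : Fin 2, ∑ j : Fin 2, α i j (μ, ν, Ψ) * ξ i * ξ j) :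
    ∃ ρ : ℝ × ℝ × ℝ → ℝ, IsPeriodicSolution U α S ρ ∧
      ∀ ρ' : ℝ × ℝ × ℝ → ℝ, IsPeriodicSolution U α S ρ' →
        ∀ p : ℝ × ℝ × ℝ, p.2.2 ∈ U → ρ' p = ρ p := by
  obtain ⟨c, d, hcd, hU⟩ := hUint
  obtain ⟨e, hsource, htarget, he, hsymm⟩ := exists_smooth_parametrization_Ioo hcd
  obtain rfl : U = e.target := hU.trans htarget.symm
  have hαmem := fun i j => pull_mem hsource he (hα i j) (hαper₁ i j) (hαper₂ i j)
  let a : Fin 2 → Fin 2 → PeriodicFunction := fun i j => ⟨pull e (α i j), hαmem i j⟩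
  have hαa : ∀ i j, Set.EqOn (α i j) (push e (a i j)) (region e.target) :=
    fun i j => push_pull (hαmem i j)
  have ha : IsElliptic lam a := by
    intro ξ p
    obtain ⟨μ, hμ, ν, hν, h⟩ := exists_mem_cell p
    simp only [h]
    have := hell ξ μ ν hμ hν (e p.2.2) (e.map_source (by simp [hsource]))
    rwa [Fin.sum_univ_two (fun i => ξ i ^ 2)]
  have hSmem := pull_mem hsource he hS hSper₁ hSper₂
  have hSS := push_pull hSmem
  obtain ⟨f, hf, hfmean⟩ := ha.exists_divGrad_eq hlam ⟨pull e S, hSmem⟩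
    ((forall_setIntegral_eq_zero_iff hsource hSS).1 hSmean)
  refine ⟨push e f, ⟨contDiffOn_push hsymm f, fun p => ?_, fun p => ?_, fun p hp => ?_,
    (forall_setIntegral_eq_zero_iff hsource (Set.eqOn_refl _ _)).2 hfmean⟩, fun ρ' hρ' p hp => ?_⟩
  · rw [← add_smul_horiz_zero, push_add_two_pi]
  · rw [← add_smul_horiz_one, push_add_two_pi]
  · rw [hSS hp, ← hf]
    exact sum_pdi_eq_push hsymm hαa (Set.eqOn_refl _ _) hp
  · obtain ⟨h1, h2, h3, h4, h5⟩ := hρ'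
    have hmem := pull_mem hsource he h1 h2 h3
    have hρ := push_pull hmem
    have h6 : divGrad a ⟨pull e ρ', hmem⟩ = ⟨pull e S, hSmem⟩ := by
      ext q
      have hq : (q.1, q.2.1, e q.2.2) ∈ region e.target := e.map_source (by simp [hsource])
      rw [← push_apply hsource, ← push_apply hsource, ← sum_pdi_eq_push hsymm hαa hρ hq, ← hSS hq]
      exact h4 _ hq
    have h7 : (⟨pull e ρ', hmem⟩ : PeriodicFunction) - f = 0 := by
      refine ha.eq_zero_of_divGrad_eq_zero hlam ?_ fun t => ?_
      · rw [divGrad_sub, h6, hf, sub_self]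
      · rw [map_sub, map_sub, (forall_setIntegral_eq_zero_iff hsource hρ).1 h5, hfmean, sub_self]
    rw [hρ hp, sub_eq_zero.1 h7]
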